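/- arXiv:2110.03793 — 5 statements merged into one kernel-verified Lean document; each statement's English description precedes it below -/
import Mathlib

section
/- Let x, y, z be nonzero real numbers and d a nonzero real number. Suppose there exists (t₁, t₂, t₃, t₄) ∈ ℝ⁴ with (t₁, t₂, t₃, t₄) ≠ (0, 0, 0, 0) and xy·t₁² + xz·t₂² + yz·t₃² + d·t₄² = 0. Then the conic xz·U² + yz·V² + W² = 0 has only the trivial real solution (U, V, W) = (0, 0, 0) if and only if d < 0 and x, y, z all have the same sign. -/
/-- The form `a U² + b V² + W²` with `a, b ≠ 0` is anisotropic over `ℝ` iff `a, b > 0`. -/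
theorem conic_anisotropic_iff {a b : ℝ} (ha : a ≠ 0) (hb : b ≠ 0) :
    (∀ U V W : ℝ, a * U ^ 2 + b * V ^ 2 + W ^ 2 = 0 → U = 0 ∧ V = 0 ∧ W = 0) ↔
      0 < a ∧ 0 < b := by
  constructor
  · intro h
    refine ⟨ha.lt_or_gt.resolve_left fun ha' => ?_, hb.lt_or_gt.resolve_left fun hb' => ?_⟩
    · have hs := Real.sq_sqrt (neg_nonneg.2 ha'.le)
      exact one_ne_zero (h 1 0 (√(-a)) (by rw [hs]; ring)).1
    · have hs := Real.sq_sqrt (neg_nonneg.2 hb'.le)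
      exact one_ne_zero (h 0 1 (√(-b)) (by rw [hs]; ring)).2.1
  · rintro ⟨ha, hb⟩ U V W h
    have hU := mul_nonneg ha.le (sq_nonneg U)
    have hV := mul_nonneg hb.le (sq_nonneg V)
    have hW := sq_nonneg W
    have hU' : a * U ^ 2 = 0 := by linarith
    have hV' : b * V ^ 2 = 0 := by linarith
    have hW' : W ^ 2 = 0 := by linarith
    simpa [ha.ne', hb.ne'] using And.intro hU' (And.intro hV' hW')

/-- A diagonal quaternary form over `ℝ` with positive first three coefficients and a nontrivial
zero has nonpositive last coefficient. -/
theorem last_coeff_nonpos_of_isotropic {a b c d t₁ t₂ t₃ t₄ : ℝ}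
    (ha : 0 < a) (hb : 0 < b) (hc : 0 < c) (ht : (t₁, t₂, t₃, t₄) ≠ (0, 0, 0, 0))
    (h : a * t₁ ^ 2 + b * t₂ ^ 2 + c * t₃ ^ 2 + d * t₄ ^ 2 = 0) : d ≤ 0 := by
  by_contra! hd
  have h₁ := mul_nonneg ha.le (sq_nonneg t₁)
  have h₂ := mul_nonneg hb.le (sq_nonneg t₂)
  have h₃ := mul_nonneg hc.le (sq_nonneg t₃)
  have h₄ := mul_nonneg hd.le (sq_nonneg t₄)
  have e₁ : a * t₁ ^ 2 = 0 := by linarith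
  have e₂ : b * t₂ ^ 2 = 0 := by linarith
  have e₃ : c * t₃ ^ 2 = 0 := by linarith
  have e₄ : d * t₄ ^ 2 = 0 := by linarith
  simp_all [ha.ne', hb.ne', hc.ne', hd.ne']

/-- Full archimedean invariant computation: at a real point of the fourfold
`xy·t₁² + xz·t₂² + yz·t₃² + d·t₄² = 0` (with `x, y, z, d` nonzero), the conic
`xz·U² + yz·V² + W² = 0` is insoluble over `ℝ` exactly when `d < 0` and
`x, y, z` all have the same sign. -/
theorem stmt_2 (x y z d : ℝ) (hx : x ≠ 0) (hy : y ≠ 0) (hz : z ≠ 0) (hd : d ≠ 0)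
    (h : ∃ t₁ t₂ t₃ t₄ : ℝ, (t₁, t₂, t₃, t₄) ≠ (0, 0, 0, 0) ∧
      x * y * t₁ ^ 2 + x * z * t₂ ^ 2 + y * z * t₃ ^ 2 + d * t₄ ^ 2 = 0) :
    (∀ U V W : ℝ, x * z * U ^ 2 + y * z * V ^ 2 + W ^ 2 = 0 → U = 0 ∧ V = 0 ∧ W = 0) ↔
      (d < 0 ∧ ((0 < x ∧ 0 < y ∧ 0 < z) ∨ (x < 0 ∧ y < 0 ∧ z < 0))) := by
  rw [conic_anisotropic_iff (mul_ne_zero hx hz) (mul_ne_zero hy hz)]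
  constructor
  · rintro ⟨hxz, hyz⟩
    have hsign : (0 < x ∧ 0 < y ∧ 0 < z) ∨ (x < 0 ∧ y < 0 ∧ z < 0) := by
      rcases pos_and_pos_or_neg_and_neg_of_mul_pos hxz with ⟨hx, hz⟩ | ⟨hx, hz⟩
      · exact .inl ⟨hx, pos_of_mul_pos_left hyz hz.le, hz⟩
      · exact .inr ⟨hx, neg_of_mul_pos_left hyz hz.le, hz⟩
    have hxy : 0 < x * y := by
      rcases hsign with ⟨hx, hy, -⟩ | ⟨hx, hy, -⟩
      · exact mul_pos hx hy
      · exact mul_pos_of_neg_of_neg hx hy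
    obtain ⟨t₁, t₂, t₃, t₄, ht, h⟩ := h
    exact ⟨(last_coeff_nonpos_of_isotropic hxy hxz hyz ht h).lt_of_ne hd, hsign⟩
  · rintro ⟨-, ⟨hx, hy, hz⟩ | ⟨hx, hy, hz⟩⟩
    · exact ⟨mul_pos hx hz, mul_pos hy hz⟩
    · exact ⟨mul_pos_of_neg_of_neg hx hz, mul_pos_of_neg_of_neg hy hz⟩
end

section
/- Let p be a prime number and let x, y, z, d be nonzero elements of the p-adic field ℚ_p such that d is a square in ℚ_p. Suppose there exists (t₁, t₂, t₃, t₄) ∈ ℚ_p⁴ with (t₁, t₂, t₃, t₄) ≠ (0, 0, 0, 0) and xy·t₁² + xz·t₂² + yz·t₃² + d·t₄² = 0. Then there exists (U, V, W) ∈ ℚ_p³ with (U, V, W) ≠ (0, 0, 0) and xz·U² + yz·V² + W² = 0. -/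
/-- If the norm form `⟨1, a, b, ab⟩` of a quaternion algebra is isotropic over a field, then so is
its ternary subform `⟨a, b, 1⟩`. -/
theorem exists_ternary_isotropic_of_pfister_isotropic {K : Type*} [Field K] {a b : K} (hb : b ≠ 0)
    {r s t w : K} (hne : (r, s, t, w) ≠ (0, 0, 0, 0))
    (h : a * b * r ^ 2 + a * s ^ 2 + b * t ^ 2 + w ^ 2 = 0) :
    ∃ U V W : K, (U, V, W) ≠ (0, 0, 0) ∧ a * U ^ 2 + b * V ^ 2 + W ^ 2 = 0 := by
  by_cases hW : w ^ 2 + a * b * r ^ 2 = 0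
  · by_cases hst : s = 0 ∧ t = 0
    · obtain ⟨rfl, rfl⟩ := hst
      have hr : r ≠ 0 := by
        rintro rfl
        simp_all
      refine ⟨b * r, w, 0, by simp [hb, hr], ?_⟩
      linear_combination b * hW
    · refine ⟨s, t, 0, by simpa using hst, ?_⟩
      linear_combination h - hW
  · refine ⟨w * s - b * r * t, w * t + a * r * s, w ^ 2 + a * b * r ^ 2, by simp [hW], ?_⟩
    linear_combination (w ^ 2 + a * b * r ^ 2) * h

/-- Non-archimedean invariant computation over `ℚ_p`: if `d` is a nonzero square in `ℚ_p`
and the rank-4 diagonal form `⟨xy, xz, yz, d⟩` is isotropic over `ℚ_p`, then the conic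
`xz·U² + yz·V² + W² = 0` has a nontrivial `ℚ_p`-solution. -/
theorem stmt_3 (p : ℕ) [Fact p.Prime] (x y z d : ℚ_[p])
    (hx : x ≠ 0) (hy : y ≠ 0) (hz : z ≠ 0) (hd : d ≠ 0) (hdsq : IsSquare d)
    (h : ∃ t₁ t₂ t₃ t₄ : ℚ_[p], (t₁, t₂, t₃, t₄) ≠ (0, 0, 0, 0) ∧
      x * y * t₁ ^ 2 + x * z * t₂ ^ 2 + y * z * t₃ ^ 2 + d * t₄ ^ 2 = 0) :
    ∃ U V W : ℚ_[p], (U, V, W) ≠ (0, 0, 0) ∧ x * z * U ^ 2 + y * z * V ^ 2 + W ^ 2 = 0 := by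
  obtain ⟨e, rfl⟩ := hdsq
  obtain ⟨t₁, t₂, t₃, t₄, hne, h⟩ := h
  have he : e ≠ 0 := left_ne_zero_of_mul hd
  refine exists_ternary_isotropic_of_pfister_isotropic (r := t₁ / z) (s := t₂) (t := t₃)
    (w := e * t₄) (mul_ne_zero hy hz) (by simpa [hz, he] using hne) ?_
  field_simp
  linear_combination h
end

section
/- Let K be a number field, let v be a finite place of K (a nonzero prime ideal of its ring of integers, i.e. an element of the height-one spectrum of 𝒪_K), and let K_v denote the v-adic completion of K. Let x, y, z, d be nonzero elements of K_v such that d is a square in K_v. Suppose there exists (t₁, t₂, t₃, t₄) ∈ K_v⁴ with (t₁, t₂, t₃, t₄) ≠ (0, 0, 0, 0) and xy·t₁² + xz·t₂² + yz·t₃² + d·t₄² = 0. Then there exists (U, V, W) ∈ K_v³ with (U, V, W) ≠ (0, 0, 0) and xz·U² + yz·V² + W² = 0. -/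
open IsDedekindDomain

/-- If the norm form `⟨1, a, b, ab⟩` of a quaternion algebra is isotropic, then so is its subform
`⟨a, b, 1⟩`. -/
theorem exists_isotropic_ternary_of_isotropic_quaternary {F : Type*} [Field F] {a b s u v w : F}
    (hne : (s, u, v, w) ≠ (0, 0, 0, 0))
    (h : s ^ 2 + a * u ^ 2 + b * v ^ 2 + a * b * w ^ 2 = 0) :
    ∃ U V W : F, (U, V, W) ≠ (0, 0, 0) ∧ a * U ^ 2 + b * V ^ 2 + W ^ 2 = 0 := by
  by_cases hn : v ^ 2 + a * w ^ 2 = 0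
  · by_cases hvw : v = 0 ∧ w = 0
    · obtain ⟨rfl, rfl⟩ := hvw
      exact ⟨u, 0, s, fun h0 ↦ hne (by simp_all), by linear_combination h⟩
    · exact ⟨w, 0, v, fun h0 ↦ hvw (by simp_all), by linear_combination hn⟩
  · exact ⟨s * w + u * v, v ^ 2 + a * w ^ 2, s * v - a * u * w, fun h0 ↦ hn (by simp_all),
      by linear_combination (v ^ 2 + a * w ^ 2) * h⟩

/-- Non-archimedean invariant computation over the completion `K_v` of a number field `K`
at a finite place `v`: if `d` is a nonzero square in `K_v` and the rank-4 diagonal form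
`⟨xy, xz, yz, d⟩` is isotropic over `K_v`, then the conic `xz·U² + yz·V² + W² = 0` has a
nontrivial `K_v`-solution. -/
theorem stmt_4 (K : Type*) [Field K] [NumberField K]
    (v : HeightOneSpectrum (NumberField.RingOfIntegers K))
    (x y z d : v.adicCompletion K)
    (hx : x ≠ 0) (hy : y ≠ 0) (hz : z ≠ 0) (hd : d ≠ 0) (hdsq : IsSquare d)
    (h : ∃ t₁ t₂ t₃ t₄ : v.adicCompletion K, (t₁, t₂, t₃, t₄) ≠ (0, 0, 0, 0) ∧
      x * y * t₁ ^ 2 + x * z * t₂ ^ 2 + y * z * t₃ ^ 2 + d * t₄ ^ 2 = 0) :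
    ∃ U V W : v.adicCompletion K, (U, V, W) ≠ (0, 0, 0) ∧
      x * z * U ^ 2 + y * z * V ^ 2 + W ^ 2 = 0 := by
  obtain ⟨e, rfl⟩ := hdsq
  obtain ⟨t₁, t₂, t₃, t₄, hne, ht⟩ := h
  have he : e ≠ 0 := left_ne_zero_of_mul hd
  refine exists_isotropic_ternary_of_isotropic_quaternary
    (s := e * t₄) (u := t₂) (v := t₃) (w := t₁ / z) (fun h0 ↦ hne ?_) ?_
  · simp only [Prod.mk.injEq, mul_eq_zero, div_eq_zero_iff, he, hz, false_or, or_false] at h0 ⊢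
    tauto
  · field_simp
    linear_combination ht
end

section
/- Let q = X·Y·t₁² + X·t₂² + Y·t₃² + (X² + Y² + 1 − 2(X·Y + X + Y)) be the polynomial in ℚ[X, Y, t₁, t₂, t₃] obtained from the Hassett–Pirutka–Tschinkel fourfold by dehomogenising z = 1 and t₄ = 1. Then: (i) the principal ideal (q) is a prime ideal of ℚ[X, Y, t₁, t₂, t₃], so the quotient ring A = ℚ[X, Y, t₁, t₂, t₃]/(q) is an integral domain; and (ii) writing L for the fraction field of A and x̄, ȳ ∈ L for the images of X and Y, the equation x̄·u² + ȳ·v² + w² = 0 has only the trivial solution (u, v, w) = (0, 0, 0) in L³. -/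
open MvPolynomial

/-- The dehomogenised (at `z = 1`, `t₄ = 1`) equation of the Hassett–Pirutka–Tschinkel
fourfold, as a polynomial over `ℚ` in the variables `X = X 0`, `Y = X 1`, `t₁ = X 2`,
`t₂ = X 3`, `t₃ = X 4`:
`q = XY·t₁² + X·t₂² + Y·t₃² + (X² + Y² + 1 − 2(XY + X + Y))`. -/
noncomputable def qHPT : MvPolynomial (Fin 5) ℚ :=
  X 0 * X 1 * X 2 ^ 2 + X 0 * X 3 ^ 2 + X 1 * X 4 ^ 2 +
    (X 0 ^ 2 + X 1 ^ 2 + 1 - 2 * (X 0 * X 1 + X 0 + X 1))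

/-- Any nondegenerate box of positive reals contains an algebraically independent point. -/
theorem exists_algebraicIndependent_mem_Ioo (n : ℕ) (a b : Fin n → ℝ) (ha : ∀ i, 0 < a i)
    (hab : ∀ i, a i < b i) :
    ∃ x : Fin n → ℝ, AlgebraicIndependent ℚ x ∧ ∀ i, x i ∈ Set.Ioo (a i) (b i) := by
  obtain ⟨s, hs⟩ := exists_isTranscendenceBasis ℚ ℝ
  have hinf : Infinite s := by
    by_contra hfin
    rw [not_infinite_iff_finite] at hfin
    have key : Cardinal.mk ℝ ≤ Cardinal.aleph0 := by
      rcases isEmpty_or_nonempty s with he | hne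
      · have := hs.isEmpty_iff_isAlgebraic.1 he
        simpa using Algebra.IsAlgebraic.cardinalMk_le_max ℚ ℝ
      · have h := hs.lift_cardinalMk_eq_max_lift
        simp only [Cardinal.lift_id] at h
        rw [h]
        simp
    exact absurd key (not_le.2 (by simp))
  let e : Fin n ↪ s := Fin.valEmbedding.trans (Infinite.natEmbedding s)
  have hy : AlgebraicIndependent ℚ (fun i => ((e i : s) : ℝ)) := hs.1.comp e e.injective
  have hy0 (i : Fin n) : ((e i : s) : ℝ) ≠ 0 := hy.ne_zero i
  have hr (i : Fin n) : ∃ r : ℚ, (r : ℝ) * (e i : s) ∈ Set.Ioo (a i) (b i) := by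
    rcases lt_or_gt_of_ne (hy0 i) with h | h
    · obtain ⟨r, h1, h2⟩ := exists_rat_btwn ((div_lt_div_right_of_neg h).2 (hab i))
      exact ⟨r, (lt_div_iff_of_neg h).1 h2, (div_lt_iff_of_neg h).1 h1⟩
    · obtain ⟨r, h1, h2⟩ := exists_rat_btwn ((div_lt_div_iff_of_pos_right h).2 (hab i))
      exact ⟨r, (div_lt_iff₀ h).1 h1, (lt_div_iff₀ h).1 h2⟩
  choose r hr using hr
  have hr0 (i : Fin n) : r i ≠ 0 := by
    intro h
    have := (hr i).1
    simp only [h, Rat.cast_zero, zero_mul] at this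
    exact absurd this (not_lt.2 (ha i).le)
  refine ⟨fun i => r i * (e i : s), ?_, hr⟩
  have ht (i : Fin n) : Transcendental ℚ (Polynomial.C (r i) * Polynomial.X) := by
    have := (Polynomial.transcendental_X ℚ).aeval (Polynomial.C (r i) * Polynomial.X)
      (by rw [Polynomial.natDegree_C_mul_X _ (hr0 i)]; exact one_ne_zero)
    simpa [Polynomial.C_eq_algebraMap, hr0 i] using this
  simpa using hy.polynomial_aeval_of_transcendental ht

/-- The coefficient of `x` in `q`, viewed as a monic quadratic in `x`. -/
noncomputable def linCoeffHPT : MvPolynomial (Fin 4) ℚ :=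
  X 0 * X 1 ^ 2 + X 2 ^ 2 - 2 * X 0 - 2

/-- The constant coefficient of `q`, viewed as a monic quadratic in `x`. -/
noncomputable def constCoeffHPT : MvPolynomial (Fin 4) ℚ :=
  X 0 * X 3 ^ 2 + (X 0 - 1) ^ 2

theorem finSuccEquiv_qHPT : finSuccEquiv ℚ 4 qHPT =
    Polynomial.X ^ 2 + Polynomial.C linCoeffHPT * Polynomial.X + Polynomial.C constCoeffHPT := by
  have h1 : finSuccEquiv ℚ 4 (X 1) = Polynomial.C (X 0) := finSuccEquiv_X_succ (j := 0)
  have h2 : finSuccEquiv ℚ 4 (X 2) = Polynomial.C (X 1) := finSuccEquiv_X_succ (j := 1)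
  have h3 : finSuccEquiv ℚ 4 (X 3) = Polynomial.C (X 2) := finSuccEquiv_X_succ (j := 2)
  have h4 : finSuccEquiv ℚ 4 (X 4) = Polynomial.C (X 3) := finSuccEquiv_X_succ (j := 3)
  simp only [qHPT, linCoeffHPT, constCoeffHPT, map_add, map_sub, map_mul, map_pow, map_one,
    map_ofNat, finSuccEquiv_X_zero, h1, h2, h3, h4]
  ring

/-- The monic quadratic `q` has no root in the field of fractions of `ℚ[y, t₁, t₂, t₃]`. -/
theorem eq_zero_of_quadratic_relation {a b : MvPolynomial (Fin 4) ℚ}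
    (h : b ^ 2 - a * b * linCoeffHPT + a ^ 2 * constCoeffHPT = 0) : a = 0 := by
  let S : Fin 4 → Set ℚ := ![Set.Icc 1 2, Set.Icc 0 1, Set.Icc 0 1, Set.Ici 4]
  refine funext_set S ?_ fun z hz => ?_
  · intro i
    fin_cases i
    · exact Set.Icc_infinite (by norm_num)
    · exact Set.Icc_infinite (by norm_num)
    · exact Set.Icc_infinite (by norm_num)
    · exact Set.Ici_infinite _
  · obtain ⟨hy1, hy2⟩ : z 0 ∈ Set.Icc (1 : ℚ) 2 := hz 0 trivial
    obtain ⟨hs1, hs2⟩ : z 1 ∈ Set.Icc (0 : ℚ) 1 := hz 1 trivial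
    obtain ⟨ht1, ht2⟩ : z 2 ∈ Set.Icc (0 : ℚ) 1 := hz 2 trivial
    have hr : (4 : ℚ) ≤ z 3 := hz 3 trivial
    have he := congrArg (eval z) h
    simp only [linCoeffHPT, constCoeffHPT, map_add, map_sub, map_mul, map_pow, map_one,
      map_ofNat, map_zero, eval_X] at he ⊢
    set A := eval z a
    set B := eval z b
    generalize z 0 = y at *
    generalize z 1 = s at *
    generalize z 2 = t at *
    generalize z 3 = r at *
    have hs : s ^ 2 ≤ 1 := by nlinarith
    have hl1 : -6 ≤ y * s ^ 2 + t ^ 2 - 2 * y - 2 := by nlinarith [sq_nonneg s, sq_nonneg t]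
    have hl2 : y * s ^ 2 + t ^ 2 - 2 * y - 2 ≤ 6 := by nlinarith
    set l := y * s ^ 2 + t ^ 2 - 2 * y - 2
    have hl : l ^ 2 ≤ 36 := by nlinarith
    have hc : 16 ≤ y * r ^ 2 + (y - 1) ^ 2 := by nlinarith [sq_nonneg (y - 1)]
    set c := y * r ^ 2 + (y - 1) ^ 2
    have hsq : (2 * B - A * l) ^ 2 + A ^ 2 * (4 * c - l ^ 2) = 0 := by linear_combination 4 * he
    have : A ^ 2 * 28 ≤ 0 := by
      nlinarith [sq_nonneg (2 * B - A * l), mul_nonneg (sq_nonneg A)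
        (by linarith : 0 ≤ 4 * c - l ^ 2 - 28)]
    exact pow_eq_zero_iff two_ne_zero |>.1 (le_antisymm (by linarith) (sq_nonneg A))

/-- A real-valued homomorphism with kernel `(q)` under which `x` and `y` become positive. -/
theorem exists_ringHom_ker_eq_span_qHPT : ∃ φ : MvPolynomial (Fin 5) ℚ →+* ℝ,
    RingHom.ker φ = Ideal.span {qHPT} ∧ 0 < φ (X 0) ∧ 0 < φ (X 1) := by
  obtain ⟨z, hz, hbox⟩ := exists_algebraicIndependent_mem_Ioo 4 ![1, 1/4, 1/4, 1/4]
    ![2, 1/2, 1/2, 1/2] (by intro i; fin_cases i <;> norm_num)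
    (by intro i; fin_cases i <;> norm_num)
  obtain ⟨hy1, hy2⟩ : z 0 ∈ Set.Ioo (1 : ℝ) 2 := hbox 0
  obtain ⟨hs1, hs2⟩ : z 1 ∈ Set.Ioo (1/4 : ℝ) (1/2) := hbox 1
  obtain ⟨ht1, ht2⟩ : z 2 ∈ Set.Ioo (1/4 : ℝ) (1/2) := hbox 2
  obtain ⟨hr1, hr2⟩ : z 3 ∈ Set.Ioo (1/4 : ℝ) (1/2) := hbox 3
  obtain ⟨x, hx0, hx⟩ : ∃ x : ℝ, 0 < x ∧
      x ^ 2 + aeval z linCoeffHPT * x + aeval z constCoeffHPT = 0 := by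
    simp only [linCoeffHPT, constCoeffHPT, map_add, map_sub, map_mul, map_pow, map_one,
      map_ofNat, aeval_X]
    generalize z 0 = y at *
    generalize z 1 = s at *
    generalize z 2 = t at *
    generalize z 3 = r at *
    have hs : s ^ 2 ≤ 1 / 4 := by nlinarith
    have ht : t ^ 2 ≤ 1 / 4 := by nlinarith
    have hr : r ^ 2 ≤ 1 / 4 := by nlinarith
    have hl : y * s ^ 2 + t ^ 2 - 2 * y - 2 ≤ -(y + 1) := by nlinarith
    have hc : y * r ^ 2 + (y - 1) ^ 2 ≤ y / 4 + (y - 1) ^ 2 := by nlinarith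
    set l := y * s ^ 2 + t ^ 2 - 2 * y - 2
    set c := y * r ^ 2 + (y - 1) ^ 2
    have hl2 : (y + 1) ^ 2 ≤ l ^ 2 := by nlinarith
    have hD : 0 ≤ l ^ 2 - 4 * c := by nlinarith
    refine ⟨(-l + √(l ^ 2 - 4 * c)) / 2, ?_, ?_⟩
    · have := Real.sqrt_nonneg (l ^ 2 - 4 * c)
      linarith
    · linear_combination (1 / 4) * Real.sq_sqrt hD
  let ψ : Polynomial (MvPolynomial (Fin 4) ℚ) →+* ℝ :=
    Polynomial.eval₂RingHom (aeval z : MvPolynomial (Fin 4) ℚ →ₐ[ℚ] ℝ).toRingHom x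
  have hψC (p : MvPolynomial (Fin 4) ℚ) : ψ (Polynomial.C p) = aeval z p := by simp [ψ]
  have hψX : ψ Polynomial.X = x := by simp [ψ]
  have hq : ψ (finSuccEquiv ℚ 4 qHPT) = 0 := by
    simpa only [finSuccEquiv_qHPT, map_add, map_mul, map_pow, hψC, hψX] using hx
  refine ⟨ψ.comp (finSuccEquiv ℚ 4).toRingEquiv.toRingHom, ?_, ?_, ?_⟩
  · refine le_antisymm (fun p hp => ?_) ?_
    · rw [Ideal.mem_span_singleton, ← map_dvd_iff (finSuccEquiv ℚ 4)]
      have hp : ψ (finSuccEquiv ℚ 4 p) = 0 := hp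
      generalize finSuccEquiv ℚ 4 p = P at hp
      set Q := finSuccEquiv ℚ 4 qHPT with hQ
      have hmonic : Q.Monic := by
        rw [hQ, finSuccEquiv_qHPT]
        monicity!
      have hdeg : Q.natDegree = 2 := by
        rw [hQ, finSuccEquiv_qHPT]
        compute_degree!
      rw [← Polynomial.modByMonic_eq_zero_iff_dvd hmonic]
      have hR : (P %ₘ Q).natDegree ≤ 1 := by
        have := Polynomial.natDegree_modByMonic_lt P hmonic (by
          intro h; rw [h] at hdeg; simp at hdeg)
        omega
      have hψR : ψ (P %ₘ Q) = 0 := by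
        rw [Polynomial.modByMonic_eq_sub_mul_div P Q, map_sub, map_mul, hq, hp]
        ring
      obtain ⟨a, b, hab⟩ := Polynomial.exists_eq_X_add_C_of_natDegree_le_one hR
      rw [hab, map_add, map_mul, hψC, hψC, hψX] at hψR
      have ha : a = 0 := by
        refine eq_zero_of_quadratic_relation (b := b) (hz ?_)
        simp only [map_add, map_sub, map_mul, map_pow, map_zero]
        linear_combination (aeval z a) ^ 2 * hx +
          (aeval z b - aeval z a * x - aeval z a * aeval z linCoeffHPT) * hψR
      have hb : b = 0 := hz (by simpa [ha] using hψR)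
      rw [hab, ha, hb]
      simp
    · rw [Ideal.span_singleton_le_iff_mem]
      exact hq
  · change 0 < ψ (finSuccEquiv ℚ 4 (X 0))
    rwa [finSuccEquiv_X_zero, hψX]
  · change 0 < ψ (finSuccEquiv ℚ 4 (X (Fin.succ 0)))
    rw [finSuccEquiv_X_succ, hψC, aeval_X]
    linarith

/-- The ideal `(q)` is prime, and in the fraction field `L` of the quotient ring
(the function field over `ℚ` of the Hassett–Pirutka–Tschinkel fourfold) the form
`⟨x̄, ȳ, 1⟩` is anisotropic: `x̄·u² + ȳ·v² + w² = 0` has only the trivial solution. -/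
theorem stmt_7 :
    (Ideal.span {qHPT}).IsPrime ∧
    ∀ u v w : FractionRing (MvPolynomial (Fin 5) ℚ ⧸ Ideal.span {qHPT}),
      algebraMap (MvPolynomial (Fin 5) ℚ ⧸ Ideal.span {qHPT})
          (FractionRing (MvPolynomial (Fin 5) ℚ ⧸ Ideal.span {qHPT}))
          (Ideal.Quotient.mk (Ideal.span {qHPT}) (X 0)) * u ^ 2
        + algebraMap (MvPolynomial (Fin 5) ℚ ⧸ Ideal.span {qHPT})
          (FractionRing (MvPolynomial (Fin 5) ℚ ⧸ Ideal.span {qHPT}))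
          (Ideal.Quotient.mk (Ideal.span {qHPT}) (X 1)) * v ^ 2
        + w ^ 2 = 0 →
      u = 0 ∧ v = 0 ∧ w = 0 := by
  obtain ⟨φ, hker, hx, hy⟩ := exists_ringHom_ker_eq_span_qHPT
  have hprime : (Ideal.span {qHPT}).IsPrime := hker ▸ RingHom.ker_isPrime φ
  refine ⟨hprime, fun u v w h => ?_⟩
  let g : MvPolynomial (Fin 5) ℚ ⧸ Ideal.span {qHPT} →+* ℝ :=
    Ideal.Quotient.lift _ φ fun p hp => by rwa [← hker] at hp
  have hg : Function.Injective g :=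
    RingHom.lift_injective_of_ker_le_ideal _ _ hker.le
  let Φ : FractionRing (MvPolynomial (Fin 5) ℚ ⧸ Ideal.span {qHPT}) →+* ℝ :=
    IsFractionRing.lift hg
  have hΦ : Function.Injective Φ := Φ.injective
  have hmap := congrArg Φ h
  simp only [map_add, map_mul, map_pow, map_zero, Φ, IsFractionRing.lift_algebraMap] at hmap
  change φ (X 0) * Φ u ^ 2 + φ (X 1) * Φ v ^ 2 + Φ w ^ 2 = 0 at hmap
  have hu := mul_nonneg hx.le (sq_nonneg (Φ u))
  have hv := mul_nonneg hy.le (sq_nonneg (Φ v))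
  have hw := sq_nonneg (Φ w)
  have hu0 : φ (X 0) * Φ u ^ 2 = 0 := by linarith
  have hv0 : φ (X 1) * Φ v ^ 2 = 0 := by linarith
  have hw0 : Φ w ^ 2 = 0 := by linarith
  rw [mul_eq_zero_iff_left hx.ne', sq_eq_zero_iff, map_eq_zero_iff Φ hΦ] at hu0
  rw [mul_eq_zero_iff_left hy.ne', sq_eq_zero_iff, map_eq_zero_iff Φ hΦ] at hv0
  rw [sq_eq_zero_iff, map_eq_zero_iff Φ hΦ] at hw0
  exact ⟨hu0, hv0, hw0⟩
end

section
/- Let q = X·Y·t₁² + X·t₂² + Y·t₃² + (X² + Y² + 1 − 2(X·Y + X + Y)) be the polynomial in ℂ[X, Y, t₁, t₂, t₃] obtained from the Hassett–Pirutka–Tschinkel fourfold by dehomogenising z = 1 and t₄ = 1. Then: (i) the principal ideal (q) is a prime ideal of ℂ[X, Y, t₁, t₂, t₃], so the quotient ring A = ℂ[X, Y, t₁, t₂, t₃]/(q) is an integral domain; and (ii) writing L for the fraction field of A and x̄, ȳ ∈ L for the images of X and Y, the equation x̄·u² + ȳ·v² + w² = 0 has only the trivial solution (u, v, w) = (0,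 0, 0) in L³. -/
open MvPolynomial

/-- The dehomogenised (at `z = 1`, `t₄ = 1`) equation of the Hassett–Pirutka–Tschinkel
fourfold, as a polynomial over `ℂ` in the variables `X = X 0`, `Y = X 1`, `t₁ = X 2`,
`t₂ = X 3`, `t₃ = X 4`:
`q = XY·t₁² + X·t₂² + Y·t₃² + (X² + Y² + 1 − 2(XY + X + Y))`. -/
noncomputable def qHPTC : MvPolynomial (Fin 5) ℂ :=
  X 0 * X 1 * X 2 ^ 2 + X 0 * X 3 ^ 2 + X 1 * X 4 ^ 2 +
    (X 0 ^ 2 + X 1 ^ 2 + 1 - 2 * (X 0 * X 1 + X 0 + X 1))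

/-- The diagonal form with coefficients `a` has only the trivial zero. -/
def DiagAnisotropic {ι R : Type*} [Fintype ι] [CommRing R] (a : ι → R) : Prop :=
  ∀ f : ι → R, ∑ i, a i * f i ^ 2 = 0 → f = 0

section Diagonal

variable {ι R K : Type*} [Fintype ι] [CommRing R] [Field K]

lemma sum_mul_sq_linear_combination (a f g : ι → R) (u v : R) :
    ∑ i, a i * (u * f i + v * g i) ^ 2 =
      u ^ 2 * ∑ i, a i * f i ^ 2 + 2 * u * v * ∑ i, a i * (f i * g i) +
        v ^ 2 * ∑ i, a i * g i ^ 2 := by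
  simp only [Finset.mul_sum, ← Finset.sum_add_distrib]
  exact Finset.sum_congr rfl fun i _ => by ring

lemma coeff_sum_C_mul_sq (a : ι → R) (f : ι → Polynomial R) {n : ℕ}
    (hf : ∀ i, (f i).natDegree ≤ n) :
    (∑ i, Polynomial.C (a i) * f i ^ 2).coeff (2 * n) = ∑ i, a i * (f i).coeff n ^ 2 := by
  simp only [Polynomial.finsetSum_coeff, Polynomial.coeff_C_mul]
  exact Finset.sum_congr rfl fun i _ => by rw [Polynomial.coeff_pow_of_natDegree_le (hf i)]

lemma natDegree_sum_C_mul_sq_le (a : ι → R) (f : ι → Polynomial R) {n : ℕ}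
    (hf : ∀ i, (f i).natDegree ≤ n) :
    (∑ i, Polynomial.C (a i) * f i ^ 2).natDegree ≤ 2 * n := by
  refine Polynomial.natDegree_sum_le_of_forall_le _ _ fun i _ => ?_
  refine (Polynomial.natDegree_C_mul_le _ _).trans (Polynomial.natDegree_pow_le.trans ?_)
  exact Nat.mul_le_mul_left _ (hf i)

namespace DiagAnisotropic

variable {a : ι → R}

/-- The top coefficients of a nonzero vector of polynomials do not cancel in an anisotropic
diagonal form. -/
lemma exists_natDegree_eq (ha : DiagAnisotropic a) {f : ι → Polynomial R} (hf : f ≠ 0) :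
    ∃ m, (∀ i, (f i).natDegree ≤ m) ∧ ∑ i, Polynomial.C (a i) * f i ^ 2 ≠ 0 ∧
      (∑ i, Polynomial.C (a i) * f i ^ 2).natDegree = 2 * m := by
  classical
  obtain ⟨j, hj⟩ := Function.ne_iff.1 hf
  obtain ⟨i, hi, him⟩ := Finset.exists_max_image (Finset.univ.filter fun i => f i ≠ 0)
    (fun i => (f i).natDegree) ⟨j, by simpa using hj⟩
  have hle : ∀ l, (f l).natDegree ≤ (f i).natDegree := fun l => by
    by_cases hl : f l = 0
    · simp [hl]
    · exact him l (by simpa using hl)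
  have hc : (∑ l, Polynomial.C (a l) * f l ^ 2).coeff (2 * (f i).natDegree) ≠ 0 := by
    rw [coeff_sum_C_mul_sq a f hle]
    intro h
    have := congrFun (ha _ h) i
    simp at this hi
    exact hi this
  refine ⟨_, hle, fun h => hc (by rw [h, Polynomial.coeff_zero]), ?_⟩
  exact le_antisymm (natDegree_sum_C_mul_sq_le a f hle) (Polynomial.le_natDegree_of_ne_zero hc)

lemma polynomial_C (ha : DiagAnisotropic a) :
    DiagAnisotropic fun i => Polynomial.C (a i) := fun f hf => by
  by_contra h
  obtain ⟨m, -, h0, -⟩ := ha.exists_natDegree_eq h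
  exact h0 hf

/-- Adding the variable of a polynomial ring as a coefficient keeps a form anisotropic. -/
lemma cons_X [IsDomain R] {n : ℕ} {a : Fin n → R} (ha : DiagAnisotropic a) :
    DiagAnisotropic (Fin.cons Polynomial.X fun i => Polynomial.C (a i) :
      Fin (n + 1) → Polynomial R) := fun f hf => by
  simp only [Fin.sum_univ_succ, Fin.cons_zero, Fin.cons_succ] at hf
  have h0 : f 0 = 0 := by
    by_contra h0
    have hX : (Polynomial.X * f 0 ^ 2).natDegree = 2 * (f 0).natDegree + 1 := by
      rw [Polynomial.natDegree_X_mul (pow_ne_zero 2 h0), Polynomial.natDegree_pow]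
    have hY := congrArg Polynomial.natDegree (eq_neg_of_add_eq_zero_left hf)
    rw [Polynomial.natDegree_neg, hX] at hY
    by_cases ht : (fun i : Fin n => f i.succ) = 0
    · have ht' : ∀ i : Fin n, f i.succ = 0 := congrFun ht
      simp [ht'] at hY
    · obtain ⟨m, -, -, hm⟩ := ha.exists_natDegree_eq ht
      omega
  have ht := ha.polynomial_C (fun i => f i.succ) (by simpa [h0] using hf)
  funext i
  exact Fin.cases h0 (fun i => congrFun ht i) i

lemma fractionRing [IsDomain R] [Algebra R K] [IsFractionRing R K] (ha : DiagAnisotropic a) :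
    DiagAnisotropic fun i => algebraMap R K (a i) := fun f hf => by
  obtain ⟨b, hb⟩ := IsLocalization.exist_integer_multiples_of_finite (nonZeroDivisors R) f
  choose g hg using hb
  have hb0 : algebraMap R K b ≠ 0 :=
    IsLocalization.to_map_ne_zero_of_mem_nonZeroDivisors K le_rfl b.2
  simp only [Algebra.smul_def] at hg
  have h : ∑ i, a i * g i ^ 2 = 0 := by
    apply FaithfulSMul.algebraMap_injective R K
    simp only [map_sum, map_mul, map_pow, hg, map_zero, mul_pow]
    simp only [mul_left_comm _ (algebraMap R K b ^ 2), ← Finset.mul_sum, hf, mul_zero]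
  funext i
  have hi := hg i
  rw [ha g h, Pi.zero_apply, map_zero] at hi
  exact (mul_eq_zero.1 hi.symm).resolve_left hb0

/-- **Cassels–Pfister theorem** for anisotropic diagonal forms: a polynomial represented over the
field of rational functions is represented over the ring of polynomials. -/
theorem cassels_pfister {a : ι → K} (ha : DiagAnisotropic a) (p : Polynomial K)
    (f : ι → Polynomial K) (s : Polynomial K) (hs : s ≠ 0)
    (h : ∑ i, Polynomial.C (a i) * f i ^ 2 = p * s ^ 2) :
    ∃ g : ι → Polynomial K, ∑ i, Polynomial.C (a i) * g i ^ 2 = p := by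
  induction hn : s.natDegree using Nat.strong_induction_on generalizing f s with
  | _ n ih =>
  let g : ι → Polynomial K := fun i => f i / s
  let r : ι → Polynomial K := fun i => f i % s
  have hfr : ∀ i, r i = 1 * f i + (-s) * g i := fun i => by
    have := EuclideanDomain.div_add_mod (f i) s
    linear_combination this
  have hr := sum_mul_sq_linear_combination (fun i => Polynomial.C (a i)) f g 1 (-s)
  simp only [← hfr, h] at hr
  by_cases hr0 : r = 0
  · refine ⟨g, mul_left_cancel₀ (pow_ne_zero 2 hs) ?_⟩
    rw [mul_comm _ p, ← h, Finset.mul_sum]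
    refine Finset.sum_congr rfl fun i _ => ?_
    have := hfr i
    rw [hr0, Pi.zero_apply] at this
    rw [show f i = s * g i by linear_combination -this]
    ring
  obtain ⟨j, hj⟩ := Function.ne_iff.1 hr0
  have hdeg : ∀ i, r i ≠ 0 → (r i).natDegree < n := fun i hi => by
    rw [← hn]
    exact Polynomial.natDegree_lt_natDegree hi (EuclideanDomain.mod_lt _ hs)
  have hnpos : 0 < n := (Nat.zero_le _).trans_lt (hdeg j hj)
  have hle : ∀ i, (r i).natDegree ≤ n - 1 := fun i => by
    by_cases hi : r i = 0
    · simp [hi]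
    · have := hdeg i hi
      omega
  obtain ⟨m, -, hne, -⟩ := ha.exists_natDegree_eq hr0
  have hrdeg := natDegree_sum_C_mul_sq_le a r hle
  set N := ∑ i, Polynomial.C (a i) * g i ^ 2
  set B := ∑ i, Polynomial.C (a i) * (f i * g i)
  set s' := (N - p) * s - 2 * (B - p * s) with hs'
  have hrs : ∑ i, Polynomial.C (a i) * r i ^ 2 = s * s' := by
    rw [hr, hs']
    ring
  rw [hrs] at hne hrdeg
  have hs'0 : s' ≠ 0 := right_ne_zero_of_mul hne
  rw [Polynomial.natDegree_mul hs hs'0, hn] at hrdeg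
  refine ih s'.natDegree (by omega) (fun i => (N - p) * f i + (-2 * (B - p * s)) * g i) s' hs'0
    ?_ rfl
  rw [sum_mul_sq_linear_combination, h, hs']
  ring

/-- Cassels' representation theorem over a field, for the value `d + a₀ X²`. -/
lemma exists_sum_eq_of_field {n : ℕ} {a : Fin (n + 1) → K} (ha : DiagAnisotropic a)
    (h2 : (2 : K) ≠ 0) (d : K) (f : Fin (n + 1) → Polynomial K) (s : Polynomial K) (hs : s ≠ 0)
    (h : ∑ i, Polynomial.C (a i) * f i ^ 2 =
      (Polynomial.C d + Polynomial.C (a 0) * Polynomial.X ^ 2) * s ^ 2) :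
    ∃ g : Fin n → K, ∑ i, a i.succ * g i ^ 2 = d := by
  obtain ⟨g, hg⟩ := ha.cassels_pfister _ f s hs h
  have hdeg : (g 0).natDegree ≤ 1 := by
    by_cases hg0 : g = 0
    · simp [hg0]
    · obtain ⟨m, hm, -, hm'⟩ := ha.exists_natDegree_eq hg0
      have : (∑ i, Polynomial.C (a i) * g i ^ 2).natDegree ≤ 2 := by
        rw [hg]
        compute_degree
      have := hm 0
      omega
  have hlin := Polynomial.eq_X_add_C_of_natDegree_le_one hdeg
  have key : ∃ t : K, (g 0).eval t ^ 2 = t ^ 2 := by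
    rw [hlin]
    generalize (g 0).coeff 1 = v
    generalize (g 0).coeff 0 = u
    simp only [Polynomial.eval_add, Polynomial.eval_mul, Polynomial.eval_C, Polynomial.eval_X]
    by_cases hv : v = 1
    · refine ⟨-u / 2, ?_⟩
      subst hv
      field_simp
      ring
    · have hv' : 1 - v ≠ 0 := sub_ne_zero.2 (Ne.symm hv)
      refine ⟨u / (1 - v), ?_⟩
      field_simp
      ring
  obtain ⟨t, ht⟩ := key
  refine ⟨fun i => (g i.succ).eval t, ?_⟩
  have h' := congrArg (Polynomial.eval t) hg
  simp only [Fin.sum_univ_succ, Polynomial.eval_add, Polynomial.eval_mul, Polynomial.eval_C,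
    Polynomial.eval_pow, Polynomial.eval_X, Polynomial.eval_finsetSum, ht] at h'
  linear_combination h'

/-- Cassels' representation theorem over a domain, up to square denominators. -/
theorem exists_sum_eq_mul_sq [IsDomain R] {n : ℕ} {a : Fin (n + 1) → R} (ha : DiagAnisotropic a)
    (h2 : (2 : R) ≠ 0) (d : R) (f : Fin (n + 1) → Polynomial R) (s : Polynomial R) (hs : s ≠ 0)
    (h : ∑ i, Polynomial.C (a i) * f i ^ 2 =
      (Polynomial.C d + Polynomial.C (a 0) * Polynomial.X ^ 2) * s ^ 2) :
    ∃ (g : Fin n → R) (b : R), b ≠ 0 ∧ ∑ i, a i.succ * g i ^ 2 = d * b ^ 2 := by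
  have hinj := FaithfulSMul.algebraMap_injective R (FractionRing R)
  have h' := congrArg (Polynomial.map (algebraMap R (FractionRing R))) h
  simp only [Polynomial.map_sum, Polynomial.map_mul, Polynomial.map_pow, Polynomial.map_add,
    Polynomial.map_C, Polynomial.map_X] at h'
  obtain ⟨g, hg⟩ := (ha.fractionRing (K := FractionRing R)).exists_sum_eq_of_field
    (by rw [← map_ofNat (algebraMap R (FractionRing R)) 2]; exact (map_ne_zero_iff _ hinj).2 h2)
    _ _ _ ((Polynomial.map_ne_zero_iff hinj).2 hs) h'
  obtain ⟨b, hb⟩ := IsLocalization.exist_integer_multiples_of_finite (nonZeroDivisors R) g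
  choose e he using hb
  simp only [Algebra.smul_def] at he
  refine ⟨e, b, nonZeroDivisors.ne_zero b.2, hinj ?_⟩
  simp only [map_sum, map_mul, map_pow, he, mul_pow]
  simp only [mul_left_comm _ (algebraMap R (FractionRing R) b ^ 2), ← Finset.mul_sum, hg]
  ring

end DiagAnisotropic

end Diagonal

section QuadraticExtension

/-- If the anisotropic form `⟨y, x, 1⟩` over a field `K` becomes isotropic modulo `T² - a`, then
`-a` is represented by the adjoint form `⟨xy, x, y⟩`. -/
lemma exists_eq_neg_of_dvd {K : Type*} [Field K] {x y a : K} (h2 : (2 : K) ≠ 0)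
    (hxy : DiagAnisotropic ![y, x, 1]) {u v w : Polynomial K}
    (h : Polynomial.X ^ 2 - Polynomial.C a ∣
      Polynomial.C x * u ^ 2 + Polynomial.C y * v ^ 2 + w ^ 2)
    (hne : ¬ (Polynomial.X ^ 2 - Polynomial.C a ∣ u ∧ Polynomial.X ^ 2 - Polynomial.C a ∣ v ∧
      Polynomial.X ^ 2 - Polynomial.C a ∣ w)) :
    ∃ p q r : K, x * y * p ^ 2 + x * q ^ 2 + y * r ^ 2 = -a := by
  set m : Polynomial K := Polynomial.X ^ 2 - Polynomial.C a with hm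
  have hmm : m.Monic := Polynomial.monic_X_pow_sub_C a two_ne_zero
  have hmd : m.natDegree = 2 := Polynomial.natDegree_X_pow_sub_C
  have hred : ∀ f : Polynomial K, ∃ (c d : K) (e : Polynomial K),
      f = m * e + (Polynomial.C c * Polynomial.X + Polynomial.C d) := fun f => by
    have hd : (f %ₘ m).natDegree ≤ 1 := by
      have := Polynomial.natDegree_modByMonic_lt f hmm (by intro h1; simp [h1] at hmd)
      omega
    refine ⟨(f %ₘ m).coeff 1, (f %ₘ m).coeff 0, f /ₘ m, ?_⟩
    rw [← Polynomial.eq_X_add_C_of_natDegree_le_one hd, add_comm, Polynomial.modByMonic_add_div]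
  obtain ⟨u₁, u₀, u', hu⟩ := hred u
  obtain ⟨v₁, v₀, v', hv⟩ := hred v
  obtain ⟨w₁, w₀, w', hw⟩ := hred w
  have haniso : ∀ b c d : K, x * b ^ 2 + y * c ^ 2 + d ^ 2 = 0 → b = 0 ∧ c = 0 ∧ d = 0 :=
    fun b c d h => by
      have h0 := hxy ![c, b, d] (by
        simp only [Fin.sum_univ_three, Matrix.cons_val]
        linear_combination h)
      exact ⟨congrFun h0 1, congrFun h0 0, congrFun h0 2⟩
  set A := x * u₁ ^ 2 + y * v₁ ^ 2 + w₁ ^ 2 with hA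
  set B := x * u₁ * u₀ + y * v₁ * v₀ + w₁ * w₀ with hB
  set D := x * u₀ ^ 2 + y * v₀ ^ 2 + w₀ ^ 2 with hD
  have hdvd : m ∣ Polynomial.C (2 * B) * Polynomial.X + Polynomial.C (D + a * A) := by
    have key : Polynomial.C (2 * B) * Polynomial.X + Polynomial.C (D + a * A) =
        (Polynomial.C x * u ^ 2 + Polynomial.C y * v ^ 2 + w ^ 2) -
        m * (Polynomial.C A + Polynomial.C x * (m * u' ^ 2 +
            2 * u' * (Polynomial.C u₁ * Polynomial.X + Polynomial.C u₀)) +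
          Polynomial.C y * (m * v' ^ 2 +
            2 * v' * (Polynomial.C v₁ * Polynomial.X + Polynomial.C v₀)) +
          (m * w' ^ 2 + 2 * w' * (Polynomial.C w₁ * Polynomial.X + Polynomial.C w₀))) := by
      rw [hu, hv, hw, hA, hB, hD]
      simp only [map_add, map_mul, map_pow, Polynomial.C_ofNat, hm]
      ring
    rw [key]
    exact dvd_sub h (dvd_mul_right _ _)
  have hzero := Polynomial.eq_zero_of_dvd_of_natDegree_lt hdvd (by
    rw [hmd]
    exact Nat.lt_succ_of_le Polynomial.natDegree_linear_le)
  have hB0 : B = 0 := by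
    have := congrArg (Polynomial.coeff · 1) hzero
    simpa [h2, Polynomial.coeff_C] using this
  have hD0 : D = -a * A := by
    have := congrArg (Polynomial.coeff · 0) hzero
    simp at this
    linear_combination this
  have hA0 : A ≠ 0 := fun h0 => by
    obtain ⟨rfl, rfl, rfl⟩ := haniso _ _ _ h0
    obtain ⟨rfl, rfl, rfl⟩ := haniso _ _ _ (show D = 0 by rw [hD0, h0, mul_zero])
    exact hne ⟨⟨u', by simp [hu]⟩, ⟨v', by simp [hv]⟩, ⟨w', by simp [hw]⟩⟩
  refine ⟨(u₁ * v₀ - v₁ * u₀) / A, (u₁ * w₀ - w₁ * u₀) / A, (v₁ * w₀ - w₁ * v₀) / A, ?_⟩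
  have hlag : x * y * (u₁ * v₀ - v₁ * u₀) ^ 2 + x * (u₁ * w₀ - w₁ * u₀) ^ 2 +
      y * (v₁ * w₀ - w₁ * v₀) ^ 2 = -a * A ^ 2 := by
    linear_combination A * hD0 - B * hB0
  simp only [div_pow]
  rw [← mul_right_inj' (pow_ne_zero 2 hA0)]
  field_simp
  linear_combination hlag

variable {S : Type*} [CommRing S] [IsDomain S]

/-- Irreducibility of `y T² + G` over a unique factorization domain, by Gauss's lemma. -/
lemma prime_C_mul_X_sq_add_C [UniqueFactorizationMonoid S] {y G : S} (hy : y ≠ 0)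
    (hprim : (Polynomial.C y * Polynomial.X ^ 2 + Polynomial.C G).IsPrimitive)
    (hG : ∀ e s : S, s ≠ 0 → y * e ^ 2 + G * s ^ 2 ≠ 0) :
    Prime (Polynomial.C y * Polynomial.X ^ 2 + Polynomial.C G) := by
  rw [← UniqueFactorizationMonoid.irreducible_iff_prime,
    hprim.irreducible_iff_irreducible_map_fraction_map (K := FractionRing S)]
  have hinj := FaithfulSMul.algebraMap_injective S (FractionRing S)
  have hy' : algebraMap S (FractionRing S) y ≠ 0 := (map_ne_zero_iff _ hinj).2 hy
  have hdeg : ((Polynomial.C y * Polynomial.X ^ 2 + Polynomial.C G).map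
      (algebraMap S (FractionRing S))).natDegree = 2 := by
    simp only [Polynomial.map_add, Polynomial.map_mul, Polynomial.map_C, Polynomial.map_pow,
      Polynomial.map_X]
    compute_degree!
  rw [Polynomial.irreducible_iff_roots_eq_zero_of_degree_le_three hdeg.ge (by omega)]
  refine Multiset.eq_zero_of_forall_notMem fun t ht => ?_
  have hroot := Polynomial.isRoot_of_mem_roots ht
  simp only [Polynomial.map_add, Polynomial.map_mul, Polynomial.map_C, Polynomial.map_pow,
    Polynomial.map_X, Polynomial.IsRoot.def, Polynomial.eval_add, Polynomial.eval_mul,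
    Polynomial.eval_C, Polynomial.eval_pow, Polynomial.eval_X] at hroot
  obtain ⟨e, s, hs, rfl⟩ := IsFractionRing.div_surjective (A := S) t
  have hs0 := nonZeroDivisors.ne_zero hs
  have hs' : algebraMap S (FractionRing S) s ≠ 0 := (map_ne_zero_iff _ hinj).2 hs0
  refine hG e s hs0 (hinj ?_)
  field_simp at hroot
  simpa [mul_comm] using hroot

/-- Anisotropy of `⟨y, x, 1⟩` modulo `y T² + G`, when `⟨xy, x, 1⟩` does not represent `G` up to
squares. -/
lemma dvd_of_dvd_sum_sq [IsGCDMonoid S] {x y G : S} (h2 : (2 : S) ≠ 0) (hy : y ≠ 0)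
    (hprim : (Polynomial.C y * Polynomial.X ^ 2 + Polynomial.C G).IsPrimitive)
    (hxy : DiagAnisotropic ![y, x, 1])
    (hG : ∀ p q r s : S, s ≠ 0 → x * y * p ^ 2 + x * q ^ 2 + r ^ 2 ≠ G * s ^ 2)
    {u v w : Polynomial S}
    (h : Polynomial.C y * Polynomial.X ^ 2 + Polynomial.C G ∣
      Polynomial.C x * u ^ 2 + Polynomial.C y * v ^ 2 + w ^ 2) :
    Polynomial.C y * Polynomial.X ^ 2 + Polynomial.C G ∣ u ∧
      Polynomial.C y * Polynomial.X ^ 2 + Polynomial.C G ∣ v ∧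
      Polynomial.C y * Polynomial.X ^ 2 + Polynomial.C G ∣ w := by
  have hinj := FaithfulSMul.algebraMap_injective S (FractionRing S)
  set φ := algebraMap S (FractionRing S) with hφ
  have hy' : φ y ≠ 0 := (map_ne_zero_iff _ hinj).2 hy
  have hassoc : Associated (Polynomial.X ^ 2 - Polynomial.C (-(φ G / φ y)))
      ((Polynomial.C y * Polynomial.X ^ 2 + Polynomial.C G).map φ) := by
    refine associated_of_dvd_dvd ⟨Polynomial.C (φ y), ?_⟩ ⟨Polynomial.C (φ y)⁻¹, ?_⟩
    · have : φ G = φ G / φ y * φ y := by field_simp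
      simp only [Polynomial.map_add, Polynomial.map_mul, Polynomial.map_C, Polynomial.map_pow,
        Polynomial.map_X, map_neg]
      rw [sub_neg_eq_add, add_mul, ← map_mul, ← this]
      ring
    · simp only [Polynomial.map_add, Polynomial.map_mul, Polynomial.map_C, Polynomial.map_pow,
        Polynomial.map_X, map_neg]
      rw [sub_neg_eq_add, add_mul, ← map_mul, mul_right_comm, ← map_mul, mul_inv_cancel₀ hy',
        map_one, one_mul, div_eq_mul_inv]
  have hiff : ∀ f : Polynomial S, Polynomial.C y * Polynomial.X ^ 2 + Polynomial.C G ∣ f ↔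
      Polynomial.X ^ 2 - Polynomial.C (-(φ G / φ y)) ∣ f.map φ := fun f => by
    rw [hprim.dvd_iff_fraction_map_dvd_fraction_map (FractionRing S), hassoc.dvd_iff_dvd_left]
  have hxy' : DiagAnisotropic ![φ y, φ x, 1] := by
    have hcoe : (fun i => φ (![y, x, 1] i)) = ![φ y, φ x, 1] := by
      funext i
      fin_cases i <;> simp
    exact hcoe ▸ hxy.fractionRing (K := FractionRing S)
  have h2' : (2 : FractionRing S) ≠ 0 := by
    rw [← map_ofNat φ 2]
    exact (map_ne_zero_iff _ hinj).2 h2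
  by_contra hne
  rw [hiff, hiff, hiff] at hne
  rw [hiff] at h
  simp only [Polynomial.map_add, Polynomial.map_mul, Polynomial.map_C, Polynomial.map_pow] at h
  obtain ⟨p, q, r, hpqr⟩ := exists_eq_neg_of_dvd h2' hxy' h hne
  obtain ⟨b, hb⟩ := IsLocalization.exist_integer_multiples_of_finite (nonZeroDivisors S) ![p, q, r]
  choose g hg using hb
  simp only [Algebra.smul_def] at hg
  have hp := hg 0
  have hq := hg 1
  have hr := hg 2
  simp only [Matrix.cons_val, ← hφ] at hp hq hr
  refine hG (g 1) (y * g 0) (y * g 2) b (nonZeroDivisors.ne_zero b.2) (hinj ?_)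
  simp only [map_add, map_mul, map_pow, hp, hq, hr]
  rw [neg_neg, eq_div_iff hy'] at hpqr
  linear_combination φ b ^ 2 * hpqr

end QuadraticExtension

section FunctionField

/-- The expression `x² + y² + 1 - 2(xy + x + y)`. -/
def hptConic {R : Type*} [CommRing R] (x y : R) : R :=
  x ^ 2 + y ^ 2 + 1 - 2 * (x * y + x + y)

/-- The discriminant `hptConic x y` is not a square in `ℂ(x, y)`. -/
lemma sq_ne_hptConic_mul_sq (p s : Polynomial (Polynomial ℂ)) (hs : s ≠ 0) :
    p ^ 2 ≠ hptConic (R := Polynomial (Polynomial ℂ)) (Polynomial.C Polynomial.X) Polynomial.X *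
      s ^ 2 := by
  intro h
  obtain ⟨m, rfl⟩ := (IsIntegrallyClosed.pow_dvd_pow_iff two_ne_zero).1
    (Dvd.intro_left _ h.symm : s ^ 2 ∣ p ^ 2)
  have hm : m ^ 2 = hptConic (R := Polynomial (Polynomial ℂ)) (Polynomial.C Polynomial.X)
      Polynomial.X := by
    apply mul_right_cancel₀ (pow_ne_zero 2 hs)
    rw [← h]
    ring
  have hform : hptConic (R := Polynomial (Polynomial ℂ)) (Polynomial.C Polynomial.X) Polynomial.X =
      Polynomial.C 1 * Polynomial.X ^ 2 +
      Polynomial.C (-2 * (Polynomial.X + 1)) * Polynomial.X +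
      Polynomial.C ((Polynomial.X - 1) ^ 2) := by
    simp only [hptConic, map_mul, map_add, map_sub, map_pow, map_neg, map_one, Polynomial.C_ofNat]
    ring
  have hdeg : m.natDegree ≤ 1 := by
    have := congrArg Polynomial.natDegree hm
    rw [Polynomial.natDegree_pow, hform] at this
    have := Polynomial.natDegree_quadratic_le (a := (1 : Polynomial ℂ))
      (b := -2 * (Polynomial.X + 1)) (c := (Polynomial.X - 1) ^ 2)
    omega
  have hlin := Polynomial.eq_X_add_C_of_natDegree_le_one hdeg
  generalize m.coeff 1 = b at hlin
  generalize m.coeff 0 = c at hlin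
  have hexp : m ^ 2 = Polynomial.C (b ^ 2) * Polynomial.X ^ 2 +
      Polynomial.C (2 * b * c) * Polynomial.X + Polynomial.C (c ^ 2) := by
    rw [hlin]
    simp only [map_mul, map_pow, Polynomial.C_ofNat]
    ring
  rw [hexp, hform] at hm
  have h2 := congrArg (Polynomial.coeff · 2) hm
  have h1 := congrArg (Polynomial.coeff · 1) hm
  have h0 := congrArg (Polynomial.coeff · 0) hm
  simp only [Polynomial.coeff_add, Polynomial.coeff_C_mul, Polynomial.coeff_X_pow,
    Polynomial.coeff_X, Polynomial.coeff_C] at h0 h1 h2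
  have hb : b ^ 2 = 1 := by
    simpa [-sq_eq_one_iff] using h2
  norm_num at h0 h1
  have h4 : (16 : Polynomial ℂ) * Polynomial.X = 0 := by
    linear_combination 4 * c ^ 2 * hb + 4 * h0 -
      (2 * b * c - 2 * (Polynomial.X + 1)) * h1
  have := congrArg (Polynomial.eval 1) h4
  norm_num at this

/-- The form `⟨y, x, 1⟩` is anisotropic over `ℂ[x][y]`. -/
lemma diagAnisotropic_y_x_one :
    DiagAnisotropic (![Polynomial.X, Polynomial.C Polynomial.X, 1] :
      Fin 3 → Polynomial (Polynomial ℂ)) := by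
  have h1 : DiagAnisotropic (fun _ => 1 : Fin 1 → ℂ) := fun f hf => by
    funext i
    rw [Subsingleton.elim i 0]
    simpa using hf
  have h3 := h1.cons_X.cons_X
  convert h3 using 1
  funext i
  fin_cases i
  · rfl
  · rfl
  · exact Polynomial.C.map_one.symm

/-- Passing from `⟨y, x, 1⟩` to the similar form `⟨xy, x, 1⟩`. -/
lemma DiagAnisotropic.mul_left {R : Type*} [CommRing R] [IsDomain R] {x y : R} (hx : x ≠ 0)
    (h : DiagAnisotropic ![y, x, 1]) : DiagAnisotropic ![x * y, x, 1] := fun f hf => by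
  simp only [Fin.sum_univ_three, Matrix.cons_val] at hf
  have h0 := h ![x * f 0, f 2, x * f 1] (by
    simp only [Fin.sum_univ_three, Matrix.cons_val]
    linear_combination x * hf)
  have ha := congrFun h0 0
  have hb := congrFun h0 1
  have hc := congrFun h0 2
  simp [hx] at ha hb hc
  funext i
  fin_cases i
  · exact ha
  · exact hc
  · exact hb

lemma DiagAnisotropic.polynomial_C_three {R : Type*} [CommRing R] {a b : R}
    (h : DiagAnisotropic ![a, b, 1]) :
    DiagAnisotropic ![Polynomial.C a, Polynomial.C b, 1] := by
  convert h.polynomial_C using 1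
  funext i
  fin_cases i <;> simp

section ConstTerm

variable {R : Type*} [CommRing R]

/-- The part `F + x t₂² + xy t₁²` of the dehomogenised equation, in `R[t₂][t₁]`. -/
noncomputable def hptConstTerm (x y F : R) : Polynomial (Polynomial R) :=
  Polynomial.C (Polynomial.C F + Polynomial.C x * Polynomial.X ^ 2) +
    Polynomial.C (Polynomial.C (x * y)) * Polynomial.X ^ 2

variable [IsDomain R] {x y F : R}

/-- `hptConstTerm x y F` is not represented by `⟨xy, x, 1⟩` over the fraction field, unless `F`
is a square. -/
lemma sum_sq_ne_hptConstTerm_mul_sq (h2 : (2 : R) ≠ 0) (hx : x ≠ 0)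
    (hxy : DiagAnisotropic ![y, x, 1]) (hF : ∀ p s : R, s ≠ 0 → p ^ 2 ≠ F * s ^ 2)
    (p q r s : Polynomial (Polynomial R)) (hs : s ≠ 0) :
    Polynomial.C (Polynomial.C x) * Polynomial.C (Polynomial.C y) * p ^ 2 +
      Polynomial.C (Polynomial.C x) * q ^ 2 + r ^ 2 ≠ hptConstTerm x y F * s ^ 2 := by
  intro h
  have h2' : (2 : Polynomial R) ≠ 0 := by
    rw [← Polynomial.C_ofNat]
    exact Polynomial.C_ne_zero.2 h2
  obtain ⟨g, b, hb, hg⟩ := (hxy.mul_left hx).polynomial_C_three.exists_sum_eq_mul_sq h2'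
    (Polynomial.C F + Polynomial.C x * Polynomial.X ^ 2) ![p, q, r] s hs (by
      rw [hptConstTerm] at h
      rw [Fin.sum_univ_three]
      simp only [Matrix.cons_val, map_mul, map_one] at h ⊢
      linear_combination h)
  have hx1 : DiagAnisotropic ![x, 1] := fun f hf => by
    have h0 := hxy ![0, f 0, f 1] (by
      simp only [Fin.sum_univ_three, Fin.sum_univ_two, Matrix.cons_val] at hf ⊢
      linear_combination hf)
    have ha := congrFun h0 1
    have hb := congrFun h0 2
    funext i
    fin_cases i
    · exact ha
    · exact hb
  obtain ⟨e, c, hc, he⟩ := hx1.exists_sum_eq_mul_sq h2 F g b hb (by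
    rw [Fin.sum_univ_two] at hg ⊢
    simp only [Matrix.cons_val, Matrix.cons_val_succ, map_one] at hg ⊢
    exact hg)
  refine hF (e 0) c hc ?_
  simpa using he

lemma leadingCoeff_hptConstTerm (hx : x ≠ 0) (hy : y ≠ 0) :
    (hptConstTerm x y F).leadingCoeff = Polynomial.C (x * y) := by
  have hxy : Polynomial.C (x * y) ≠ 0 := Polynomial.C_ne_zero.2 (mul_ne_zero hx hy)
  have hdeg : (hptConstTerm x y F).natDegree = 2 := by
    rw [hptConstTerm]
    compute_degree!
  rw [Polynomial.leadingCoeff, hdeg, hptConstTerm, Polynomial.coeff_add,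
    Polynomial.coeff_C_mul, Polynomial.coeff_X_pow, Polynomial.coeff_C]
  simp

/-- `-y · hptConstTerm x y F` is not a square in the fraction field. -/
lemma mul_sq_add_hptConstTerm_mul_sq_ne_zero (hx : x ≠ 0) (hy : y ≠ 0)
    (hxy : DiagAnisotropic ![y, x, 1]) (e s : Polynomial (Polynomial R)) (hs : s ≠ 0) :
    Polynomial.C (Polynomial.C y) * e ^ 2 + hptConstTerm x y F * s ^ 2 ≠ 0 := by
  intro h
  have hlc := congrArg Polynomial.leadingCoeff (eq_neg_of_add_eq_zero_left h)
  rw [Polynomial.leadingCoeff_neg, Polynomial.leadingCoeff_mul, Polynomial.leadingCoeff_mul,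
    Polynomial.leadingCoeff_pow, Polynomial.leadingCoeff_pow, Polynomial.leadingCoeff_C,
    leadingCoeff_hptConstTerm hx hy, map_mul] at hlc
  have hz : Polynomial.C x * s.leadingCoeff ^ 2 + e.leadingCoeff ^ 2 = 0 := by
    apply mul_left_cancel₀ (Polynomial.C_ne_zero.2 hy)
    linear_combination hlc
  have h0 := hxy.polynomial_C_three ![0, s.leadingCoeff, e.leadingCoeff] (by
    simp only [Fin.sum_univ_three, Matrix.cons_val]
    linear_combination hz)
  exact hs (Polynomial.leadingCoeff_eq_zero.1 (congrFun h0 1))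

lemma isPrimitive_mul_X_sq_add_hptConstTerm (hy : Prime y) (hyx : ¬ y ∣ x) :
    (Polynomial.C (Polynomial.C (Polynomial.C y)) * Polynomial.X ^ 2 +
      Polynomial.C (hptConstTerm x y F)).IsPrimitive := by
  intro r hr
  rw [Polynomial.C_dvd_iff_dvd_coeff] at hr
  have hry : r ∣ Polynomial.C (Polynomial.C y) := by
    simpa [Polynomial.coeff_C] using hr 2
  have hrG : r ∣ hptConstTerm x y F := by
    simpa using hr 0
  have hirr : Irreducible (Polynomial.C (Polynomial.C y)) :=
    (Polynomial.prime_C_iff.2 (Polynomial.prime_C_iff.2 hy)).irreducible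
  refine (hirr.dvd_iff.1 hry).resolve_right fun hass => hyx ?_
  have hG := hass.dvd.trans hrG
  rw [Polynomial.C_dvd_iff_dvd_coeff] at hG
  have hG0 := hG 0
  rw [hptConstTerm, Polynomial.coeff_add, Polynomial.coeff_C_mul, Polynomial.coeff_X_pow,
    Polynomial.coeff_C_zero, if_neg (by decide), mul_zero, add_zero,
    Polynomial.C_dvd_iff_dvd_coeff] at hG0
  simpa [Polynomial.coeff_C] using hG0 2

end ConstTerm

/-- `ℂ[X, Y]` as the iterated polynomial ring `ℂ[x][y]`. -/
noncomputable def mvPolynomialFinTwoEquiv :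
    MvPolynomial (Fin 2) ℂ ≃+* Polynomial (Polynomial ℂ) :=
  RingEquiv.ofRingHom
    (eval₂Hom (Polynomial.C.comp Polynomial.C) ![Polynomial.C Polynomial.X, Polynomial.X])
    (Polynomial.eval₂RingHom (Polynomial.eval₂RingHom C (X 0)) (X 1))
    (by
      refine Polynomial.ringHom_ext' (Polynomial.ringHom_ext' (RingHom.ext fun r => ?_) ?_) ?_ <;>
      simp)
    (by
      refine MvPolynomial.ringHom_ext (fun r => ?_) fun i => ?_
      · simp
      · fin_cases i <;> simp)

lemma mvPolynomialFinTwoEquiv_X_zero :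
    mvPolynomialFinTwoEquiv (X 0) = Polynomial.C Polynomial.X := by
  simp [mvPolynomialFinTwoEquiv]

lemma mvPolynomialFinTwoEquiv_X_one :
    mvPolynomialFinTwoEquiv (X 1) = Polynomial.X := by
  simp [mvPolynomialFinTwoEquiv]

section Iterated

variable {R : Type*} [CommRing R] (e : MvPolynomial (Fin 2) ℂ ≃+* R)

/-- The polynomial ring in five variables as an iterated polynomial ring, the variables being
adjoined in the order `t₂, t₁, t₃` to a ring isomorphic to `ℂ[X, Y]`. -/
noncomputable def iteratedPolynomialEquiv : MvPolynomial (Fin 5) ℂ ≃+*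
    Polynomial (Polynomial (Polynomial R)) :=
  RingEquiv.ofRingHom
    (eval₂Hom ((Polynomial.C.comp (Polynomial.C.comp Polynomial.C)).comp
        ((e : MvPolynomial (Fin 2) ℂ →+* R).comp C))
      ![Polynomial.C (Polynomial.C (Polynomial.C (e (X 0)))),
        Polynomial.C (Polynomial.C (Polynomial.C (e (X 1)))),
        Polynomial.C Polynomial.X,
        Polynomial.C (Polynomial.C Polynomial.X),
        Polynomial.X])
    (Polynomial.eval₂RingHom (Polynomial.eval₂RingHom (Polynomial.eval₂RingHom
      ((eval₂Hom C ![X 0, X 1]).comp (e.symm : R →+* MvPolynomial (Fin 2) ℂ)) (X 3)) (X 2)) (X 4))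
    (by
      refine Polynomial.ringHom_ext' (Polynomial.ringHom_ext' (Polynomial.ringHom_ext'
        ((RingHom.cancel_right (f := (e : MvPolynomial (Fin 2) ℂ →+* R)) e.surjective).1
          (MvPolynomial.ringHom_ext (fun r => ?_) fun i => ?_)) ?_) ?_) ?_
      · simp
      · fin_cases i <;> simp
      all_goals simp)
    (by
      refine MvPolynomial.ringHom_ext (fun r => ?_) fun i => ?_
      · simp
      · fin_cases i <;> simp)

lemma iteratedPolynomialEquiv_X (i : Fin 5) : iteratedPolynomialEquiv e (X i) =
    ![Polynomial.C (Polynomial.C (Polynomial.C (e (X 0)))),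
      Polynomial.C (Polynomial.C (Polynomial.C (e (X 1)))),
      Polynomial.C Polynomial.X,
      Polynomial.C (Polynomial.C Polynomial.X),
      Polynomial.X] i := by
  simp [iteratedPolynomialEquiv]

lemma iteratedPolynomialEquiv_qHPTC : iteratedPolynomialEquiv e qHPTC =
    Polynomial.C (Polynomial.C (Polynomial.C (e (X 1)))) * Polynomial.X ^ 2 +
      Polynomial.C (hptConstTerm (e (X 0)) (e (X 1)) (hptConic (e (X 0)) (e (X 1)))) := by
  simp only [qHPTC, hptConstTerm, hptConic, map_add, map_sub, map_mul, map_pow, map_one,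
    map_ofNat, iteratedPolynomialEquiv_X, Matrix.cons_val]
  ring

variable [IsDomain R] [UniqueFactorizationMonoid R]

lemma prime_qHPTC_of_equiv (hy : Prime (e (X 1))) (hyx : ¬ e (X 1) ∣ e (X 0))
    (hxy : DiagAnisotropic ![e (X 1), e (X 0), 1]) : Prime qHPTC := by
  have hx : e (X 0) ≠ 0 := fun h => hyx (h ▸ dvd_zero _)
  refine comap_prime (iteratedPolynomialEquiv e) (iteratedPolynomialEquiv e).symm
    (fun a => (iteratedPolynomialEquiv e).symm_apply_apply a) ?_
  rw [iteratedPolynomialEquiv_qHPTC]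
  exact prime_C_mul_X_sq_add_C (Polynomial.C_ne_zero.2 (Polynomial.C_ne_zero.2 hy.ne_zero))
    (isPrimitive_mul_X_sq_add_hptConstTerm hy hyx)
    (mul_sq_add_hptConstTerm_mul_sq_ne_zero hx hy.ne_zero hxy)

lemma qHPTC_dvd_of_equiv (hy : Prime (e (X 1))) (hyx : ¬ e (X 1) ∣ e (X 0))
    (hxy : DiagAnisotropic ![e (X 1), e (X 0), 1])
    (hF : ∀ p s : R, s ≠ 0 → p ^ 2 ≠ hptConic (e (X 0)) (e (X 1)) * s ^ 2)
    {u v w : MvPolynomial (Fin 5) ℂ} (h : qHPTC ∣ X 0 * u ^ 2 + X 1 * v ^ 2 + w ^ 2) :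
    qHPTC ∣ u ∧ qHPTC ∣ v ∧ qHPTC ∣ w := by
  have hx : e (X 0) ≠ 0 := fun h => hyx (h ▸ dvd_zero _)
  have h2 : (2 : R) ≠ 0 := by
    rw [← map_ofNat e 2]
    exact (map_ne_zero_iff _ e.injective).2 two_ne_zero
  have h2' : (2 : Polynomial (Polynomial R)) ≠ 0 := by
    rw [← Polynomial.C_ofNat, ← Polynomial.C_ofNat]
    exact Polynomial.C_ne_zero.2 (Polynomial.C_ne_zero.2 h2)
  have hdvd : ∀ f, qHPTC ∣ f ↔
      Polynomial.C (Polynomial.C (Polynomial.C (e (X 1)))) * Polynomial.X ^ 2 +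
        Polynomial.C (hptConstTerm (e (X 0)) (e (X 1)) (hptConic (e (X 0)) (e (X 1)))) ∣
          iteratedPolynomialEquiv e f := fun f => by
    rw [← iteratedPolynomialEquiv_qHPTC, map_dvd_iff]
  rw [hdvd] at h
  rw [hdvd, hdvd, hdvd]
  simp only [map_add, map_mul, map_pow, iteratedPolynomialEquiv_X, Matrix.cons_val] at h
  exact dvd_of_dvd_sum_sq h2' (Polynomial.C_ne_zero.2 (Polynomial.C_ne_zero.2 hy.ne_zero))
    (isPrimitive_mul_X_sq_add_hptConstTerm hy hyx) hxy.polynomial_C_three.polynomial_C_three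
    (sum_sq_ne_hptConstTerm_mul_sq h2 hx hxy hF) h

end Iterated

lemma not_X_dvd_C_X : ¬ (Polynomial.X : Polynomial (Polynomial ℂ)) ∣ Polynomial.C Polynomial.X := by
  rw [Polynomial.X_dvd_iff, Polynomial.coeff_C_zero]
  exact Polynomial.X_ne_zero

lemma prime_qHPTC : Prime qHPTC := by
  apply prime_qHPTC_of_equiv mvPolynomialFinTwoEquiv <;>
    rw [mvPolynomialFinTwoEquiv_X_one] <;> try rw [mvPolynomialFinTwoEquiv_X_zero]
  · exact Polynomial.prime_X
  · exact not_X_dvd_C_X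
  · exact diagAnisotropic_y_x_one

/-- The form `⟨x̄, ȳ, 1⟩` is anisotropic modulo `qHPTC`. -/
lemma qHPTC_dvd_of_dvd_sum_sq {u v w : MvPolynomial (Fin 5) ℂ}
    (h : qHPTC ∣ X 0 * u ^ 2 + X 1 * v ^ 2 + w ^ 2) : qHPTC ∣ u ∧ qHPTC ∣ v ∧ qHPTC ∣ w := by
  refine qHPTC_dvd_of_equiv mvPolynomialFinTwoEquiv ?_ ?_ ?_ ?_ h <;>
    rw [mvPolynomialFinTwoEquiv_X_one] <;> try rw [mvPolynomialFinTwoEquiv_X_zero]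
  · exact Polynomial.prime_X
  · exact not_X_dvd_C_X
  · exact diagAnisotropic_y_x_one
  · exact sq_ne_hptConic_mul_sq

end FunctionField

/-- The ideal `(q)` is prime, and in the fraction field `L` of the quotient ring
(the function field over `ℂ` of the Hassett–Pirutka–Tschinkel fourfold) the form
`⟨x̄, ȳ, 1⟩` is anisotropic: `x̄·u² + ȳ·v² + w² = 0` has only the trivial solution. -/
theorem stmt_8 :
    (Ideal.span {qHPTC}).IsPrime ∧
    ∀ u v w : FractionRing (MvPolynomial (Fin 5) ℂ ⧸ Ideal.span {qHPTC}),
      algebraMap (MvPolynomial (Fin 5) ℂ ⧸ Ideal.span {qHPTC})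
          (FractionRing (MvPolynomial (Fin 5) ℂ ⧸ Ideal.span {qHPTC}))
          (Ideal.Quotient.mk (Ideal.span {qHPTC}) (X 0)) * u ^ 2
        + algebraMap (MvPolynomial (Fin 5) ℂ ⧸ Ideal.span {qHPTC})
          (FractionRing (MvPolynomial (Fin 5) ℂ ⧸ Ideal.span {qHPTC}))
          (Ideal.Quotient.mk (Ideal.span {qHPTC}) (X 1)) * v ^ 2
        + w ^ 2 = 0 →
      u = 0 ∧ v = 0 ∧ w = 0 := by
  have hprime : (Ideal.span {qHPTC}).IsPrime :=
    (Ideal.span_singleton_prime prime_qHPTC.ne_zero).2 prime_qHPTC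
  refine ⟨hprime, fun u v w h => ?_⟩
  have hinj := FaithfulSMul.algebraMap_injective (MvPolynomial (Fin 5) ℂ ⧸ Ideal.span {qHPTC})
    (FractionRing (MvPolynomial (Fin 5) ℂ ⧸ Ideal.span {qHPTC}))
  obtain ⟨b, hb⟩ := IsLocalization.exist_integer_multiples_of_finite
    (nonZeroDivisors (MvPolynomial (Fin 5) ℂ ⧸ Ideal.span {qHPTC})) ![u, v, w]
  choose g hg using hb
  simp only [Algebra.smul_def] at hg
  have hb0 := IsLocalization.to_map_ne_zero_of_mem_nonZeroDivisors
    (FractionRing (MvPolynomial (Fin 5) ℂ ⧸ Ideal.span {qHPTC})) le_rfl b.2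
  have hu := hg 0
  have hv := hg 1
  have hw := hg 2
  simp only [Matrix.cons_val] at hu hv hw
  obtain ⟨p, hp⟩ := Ideal.Quotient.mk_surjective (g 0)
  obtain ⟨q, hq⟩ := Ideal.Quotient.mk_surjective (g 1)
  obtain ⟨r, hr⟩ := Ideal.Quotient.mk_surjective (g 2)
  have hsum : Ideal.Quotient.mk (Ideal.span {qHPTC}) (X 0 * p ^ 2 + X 1 * q ^ 2 + r ^ 2) = 0 := by
    apply hinj
    simp only [map_add, map_mul, map_pow, hp, hq, hr, hu, hv, hw, map_zero]
    linear_combination (algebraMap _ _ (b : MvPolynomial (Fin 5) ℂ ⧸ Ideal.span {qHPTC})) ^ 2 * h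
  rw [Ideal.Quotient.eq_zero_iff_dvd] at hsum
  obtain ⟨hp', hq', hr'⟩ := qHPTC_dvd_of_dvd_sum_sq hsum
  rw [← Ideal.Quotient.eq_zero_iff_dvd] at hp' hq' hr'
  rw [← hp, hp', map_zero] at hu
  rw [← hq, hq', map_zero] at hv
  rw [← hr, hr', map_zero] at hw
  exact ⟨(mul_eq_zero.1 hu.symm).resolve_left hb0, (mul_eq_zero.1 hv.symm).resolve_left hb0,
    (mul_eq_zero.1 hw.symm).resolve_left hb0⟩
end
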